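/- arXiv:1701.05538 — 5 statements merged into one kernel-verified Lean document; each statement's English description precedes it below -/
import Mathlib

section
/- Let f be a meromorphic function on the open unit disc 𝔻 that extends continuously to the closed unit disc as a map into the Riemann sphere, and suppose |f(ζ)| = 1 for all ζ on the unit circle 𝕋. Then there exist finite Blaschke products B₁ and B₂ such that f = B₁/B₂ on 𝔻. -/
open Complex Metric Set OnePoint

/-- The finite Blaschke product with unimodular constant `c` and zeros parameters `a k ∈ 𝔻`. -/
noncomputable def finBlaschke (n : ℕ) (c : ℂ) (a : Fin n → ℂ) : ℂ → ℂ :=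
  fun z => c * ∏ k, (a k - z) / (1 - (starRingEnd ℂ) (a k) * z)

/-- `f` is a finite Blaschke product on the set `s`. -/
def IsFiniteBlaschkeOn (f : ℂ → ℂ) (s : Set ℂ) : Prop :=
  ∃ (n : ℕ) (c : ℂ) (a : Fin n → ℂ),
    ‖c‖ = 1 ∧ (∀ k, ‖a k‖ < 1) ∧ Set.EqOn f (finBlaschke n c a) s

lemma one_sub_conj_mul_ne_zero {u z : ℂ} (hu : ‖u‖ < 1) (hz : ‖z‖ ≤ 1) :
    1 - (starRingEnd ℂ) u * z ≠ 0 := by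
  intro h
  have h1 : (starRingEnd ℂ) u * z = 1 := (sub_eq_zero.mp h).symm
  have h2 : ‖u‖ * ‖z‖ = 1 := by simpa using congrArg norm h1
  nlinarith [norm_nonneg u, norm_nonneg z]

/-- The elementary Blaschke factor vanishing at `u`. -/
noncomputable def blaschkeFactor (u z : ℂ) : ℂ := (u - z) / (1 - (starRingEnd ℂ) u * z)

lemma norm_blaschkeFactor_eq_one {u z : ℂ} (hu : ‖u‖ < 1) (hz : ‖z‖ = 1) :
    ‖blaschkeFactor u z‖ = 1 := by
  have hzz : (starRingEnd ℂ) z * z = 1 := by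
    rw [mul_comm, Complex.mul_conj, Complex.normSq_eq_norm_sq, hz]; simp
  have h1 : 1 - (starRingEnd ℂ) u * z = (starRingEnd ℂ) (z - u) * z := by
    rw [map_sub, sub_mul, hzz]
  have h2 : ‖1 - (starRingEnd ℂ) u * z‖ = ‖u - z‖ := by
    rw [h1, norm_mul, RCLike.norm_conj, hz, mul_one, norm_sub_rev]
  rw [blaschkeFactor, norm_div, h2, div_self]
  rw [← h2]
  exact norm_ne_zero_iff.mpr (one_sub_conj_mul_ne_zero hu hz.le)

lemma continuousAt_blaschkeFactor {u z : ℂ} (hu : ‖u‖ < 1) (hz : ‖z‖ ≤ 1) :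
    ContinuousAt (blaschkeFactor u) z :=
  ContinuousAt.div (by fun_prop) (by fun_prop) (one_sub_conj_mul_ne_zero hu hz)

/-- The product of Blaschke factors over a finite set of zeros with multiplicities. -/
noncomputable def blaschkeProd (S : Finset ℂ) (e : ℂ → ℕ) (z : ℂ) : ℂ :=
  ∏ u ∈ S, blaschkeFactor u z ^ e u

lemma norm_blaschkeProd_eq_one {S : Finset ℂ} (hS : ∀ u ∈ S, ‖u‖ < 1) (e : ℂ → ℕ) {z : ℂ}
    (hz : ‖z‖ = 1) : ‖blaschkeProd S e z‖ = 1 := by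
  rw [blaschkeProd, norm_prod]
  refine Finset.prod_eq_one fun u hu => ?_
  rw [norm_pow, norm_blaschkeFactor_eq_one (hS u hu) hz, one_pow]

lemma continuousAt_blaschkeProd {S : Finset ℂ} (hS : ∀ u ∈ S, ‖u‖ < 1) (e : ℂ → ℕ) {z : ℂ}
    (hz : ‖z‖ ≤ 1) : ContinuousAt (blaschkeProd S e) z :=
  tendsto_finsetProd _ fun u hu => (continuousAt_blaschkeFactor (hS u hu) hz).pow _

namespace IsFiniteBlaschkeOn

lemma const {c : ℂ} (hc : ‖c‖ = 1) (s : Set ℂ) : IsFiniteBlaschkeOn (fun _ => c) s :=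
  ⟨0, c, fun _ => 0, hc, fun k => k.elim0, fun z _ => by simp [finBlaschke]⟩

lemma factor {u : ℂ} (hu : ‖u‖ < 1) (s : Set ℂ) : IsFiniteBlaschkeOn (blaschkeFactor u) s :=
  ⟨1, 1, fun _ => u, norm_one, fun _ => hu, fun z _ => by simp [finBlaschke, blaschkeFactor]⟩

lemma mul {f g : ℂ → ℂ} {s : Set ℂ} (hf : IsFiniteBlaschkeOn f s) (hg : IsFiniteBlaschkeOn g s) :
    IsFiniteBlaschkeOn (fun z => f z * g z) s := by
  obtain ⟨n, c, a, hc, ha, hfe⟩ := hf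
  obtain ⟨m, d, b, hd, hb, hge⟩ := hg
  refine ⟨n + m, c * d, Fin.append a b, by simp [hc, hd], fun k => ?_, fun z hz => ?_⟩
  · refine Fin.addCases (fun i => ?_) (fun i => ?_) k
    · simpa using ha i
    · simpa using hb i
  · simp only [hfe hz, hge hz, finBlaschke, Fin.prod_univ_add, Fin.append_left, Fin.append_right]
    ring

lemma pow {f : ℂ → ℂ} {s : Set ℂ} (hf : IsFiniteBlaschkeOn f s) (k : ℕ) :
    IsFiniteBlaschkeOn (fun z => f z ^ k) s := by
  induction k with
  | zero => simpa using const norm_one s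
  | succ k ih => simpa only [pow_succ] using ih.mul hf

lemma prod {S : Finset ℂ} (hS : ∀ u ∈ S, ‖u‖ < 1) (e : ℂ → ℕ) (s : Set ℂ) :
    IsFiniteBlaschkeOn (blaschkeProd S e) s := by
  unfold blaschkeProd
  induction S using Finset.induction_on with
  | empty => simpa using const norm_one s
  | insert u T hu ih =>
    simp only [Finset.prod_insert hu]
    exact ((factor (hS u (by simp)) s).pow _).mul
      (ih fun v hv => hS v (Finset.mem_insert_of_mem hv))

end IsFiniteBlaschkeOn

/-- Rewriting a factorized rational function as a quotient of Blaschke products times a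
nonvanishing factor. -/
lemma prod_zpow_mul_blaschkeProd {S : Finset ℂ} (hS : ∀ u ∈ S, ‖u‖ < 1) (D : ℂ → ℤ) {z : ℂ}
    (hz : ‖z‖ ≤ 1) (hzS : z ∉ S) :
    (∏ u ∈ S, (z - u) ^ D u) * blaschkeProd S (fun u => (-D u).toNat) z =
      (∏ u ∈ S, (-(1 - (starRingEnd ℂ) u * z)) ^ D u) *
        blaschkeProd S (fun u => (D u).toNat) z := by
  simp only [blaschkeProd, ← Finset.prod_mul_distrib]
  refine Finset.prod_congr rfl fun u hu => ?_
  have hq := one_sub_conj_mul_ne_zero (hS u hu) hz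
  have huz : u - z ≠ 0 := sub_ne_zero.mpr fun h => hzS (h ▸ hu)
  have hb : blaschkeFactor u z ≠ 0 := div_ne_zero huz hq
  have hzu : z - u = -(1 - (starRingEnd ℂ) u * z) * blaschkeFactor u z := by
    rw [blaschkeFactor, neg_mul, mul_div_cancel₀ _ hq, neg_sub]
  rw [hzu, mul_zpow, mul_assoc, ← zpow_natCast, ← zpow_natCast, ← zpow_add₀ hb]
  congr 2
  omega

/-- A nonvanishing function on the disc whose boundary values are unimodular is a unimodular
constant. -/
lemma exists_eqOn_const_of_norm_eq_one_on_sphere {H : ℂ → ℂ} (hd : DiffContOnCl ℂ H (ball 0 1))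
    (h0 : ∀ z ∈ ball (0 : ℂ) 1, H z ≠ 0) (h1 : ∀ z ∈ sphere (0 : ℂ) 1, ‖H z‖ = 1) :
    ∃ c : ℂ, ‖c‖ = 1 ∧ ∀ z ∈ ball (0 : ℂ) 1, H z = c := by
  have hcl : closure (ball (0 : ℂ) 1) = closedBall 0 1 := closure_ball _ one_ne_zero
  have hfr : frontier (ball (0 : ℂ) 1) = sphere 0 1 := frontier_ball _ one_ne_zero
  have hne : ∀ z ∈ closure (ball (0 : ℂ) 1), H z ≠ 0 := by
    intro z hz
    rw [hcl, ← ball_union_sphere] at hz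
    rcases hz with hz | hz
    · exact h0 z hz
    · exact norm_ne_zero_iff.mp (by rw [h1 z hz]; exact one_ne_zero)
  have hle : ∀ z ∈ ball (0 : ℂ) 1, ‖H z‖ ≤ 1 := fun z hz =>
    norm_le_of_forall_mem_frontier_norm_le isBounded_ball hd
      (fun w hw => (h1 w (hfr ▸ hw)).le) (subset_closure hz)
  have hge : ∀ z ∈ ball (0 : ℂ) 1, ‖H⁻¹ z‖ ≤ 1 := fun z hz =>
    norm_le_of_forall_mem_frontier_norm_le isBounded_ball (hd.inv hne)
      (fun w hw => by simp [h1 w (hfr ▸ hw)]) (subset_closure hz)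
  have heq : ∀ z ∈ ball (0 : ℂ) 1, ‖H z‖ = 1 := fun z hz => by
    refine le_antisymm (hle z hz) ?_
    have := hge z hz
    rw [Pi.inv_apply, norm_inv] at this
    exact (inv_le_one₀ (norm_pos_iff.mpr (h0 z hz))).mp this
  have h00 : (0 : ℂ) ∈ ball (0 : ℂ) 1 := by simp
  refine ⟨H 0, heq 0 h00, fun z hz => ?_⟩
  refine eqOn_of_isPreconnected_of_isMaxOn_norm (convex_ball _ _).isPreconnected isOpen_ball
    hd.differentiableOn h00 (fun w hw => ?_) hz
  simp [heq w hw, heq 0 h00]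

/-- If `F` is a continuous lift of `f` near a point where `F` is finite, then `f` is
continuous there. -/
lemma continuousAt_of_continuousAt_onePoint {f : ℂ → ℂ} {F : ℂ → OnePoint ℂ} {z : ℂ}
    (hF : ContinuousAt F z) (hfin : F z ≠ ∞)
    (hagree : ∀ᶠ w in nhds z, F w ≠ ∞ → F w = (f w : OnePoint ℂ)) : ContinuousAt f z := by
  rw [isOpenEmbedding_coe.isInducing.continuousAt_iff]
  refine hF.congr ?_
  filter_upwards [hagree, hF.eventually_ne hfin] with w h1 h2 using h1 h2

/-- The finite part of a point of the Riemann sphere (`0` at infinity) is continuous away from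
infinity. -/
lemma continuousAt_onePoint_elim (w : ℂ) :
    ContinuousAt (fun p : OnePoint ℂ => p.elim 0 id) (w : OnePoint ℂ) := by
  rw [OnePoint.continuousAt_coe]
  exact continuousAt_id

/-- A meromorphic function on the disc with unimodular boundary values has finite order
everywhere and only finitely many zeros and poles. -/
lemma order_ne_top_and_finite_divisor_support
    {f : ℂ → ℂ} {F : ℂ → OnePoint ℂ}
    (hf : MeromorphicOn f (ball (0:ℂ) 1))
    (hF : ContinuousOn F (closedBall (0:ℂ) 1))
    (hagree : ∀ z ∈ ball (0:ℂ) 1, F z ≠ (∞ : OnePoint ℂ) → F z = (f z : OnePoint ℂ))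
    (hcirc : ∀ ζ ∈ sphere (0:ℂ) 1, ∃ w : ℂ, F ζ = (w : OnePoint ℂ) ∧ ‖w‖ = 1) :
    (∀ u : ball (0:ℂ) 1, meromorphicOrderAt f u ≠ ⊤) ∧
      (MeromorphicOn.divisor f (ball (0:ℂ) 1)).support.Finite := by
  set O : Set (OnePoint ℂ) := (fun w : ℂ => (w : OnePoint ℂ)) '' {0}ᶜ with hO
  have hOo : IsOpen O := isOpenEmbedding_coe.isOpenMap _ isOpen_compl_singleton
  have hsphere : ∀ ζ ∈ sphere (0:ℂ) 1, F ζ ∈ O := by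
    intro ζ hζ
    obtain ⟨w, hw, hw1⟩ := hcirc ζ hζ
    exact ⟨w, norm_ne_zero_iff.mp (by rw [hw1]; exact one_ne_zero), hw.symm⟩
  set K : Set ℂ := closedBall 0 1 ∩ F ⁻¹' Oᶜ with hK
  have hKc : IsCompact K := (isCompact_closedBall _ _).of_isClosed_subset
    (hF.preimage_isClosed_of_isClosed isClosed_closedBall hOo.isClosed_compl) inter_subset_left
  have hKb : K ⊆ ball 0 1 := by
    rintro z ⟨hz, hzO⟩
    rw [← ball_union_sphere] at hz
    exact hz.resolve_right fun h => hzO (hsphere z h)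
  have hord : ∀ z ∈ ball (0:ℂ) 1, z ∉ K → meromorphicOrderAt f z = 0 := by
    intro z hz hzK
    have hzO : F z ∈ O := by
      by_contra h
      exact hzK ⟨ball_subset_closedBall hz, h⟩
    obtain ⟨w, hw0, hw⟩ := hzO
    have hfin : F z ≠ ∞ := by rw [← hw]; exact coe_ne_infty w
    have hfz : f z = w := by
      have := hagree z hz hfin
      rw [← hw] at this
      exact (coe_injective this).symm
    have hnhds : ball (0:ℂ) 1 ∈ nhds z := isOpen_ball.mem_nhds hz
    have hcont : ContinuousAt f z := continuousAt_of_continuousAt_onePoint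
      (hF.continuousAt (Filter.mem_of_superset hnhds ball_subset_closedBall)) hfin
      (Filter.eventually_of_mem hnhds hagree)
    rw [← tendsto_ne_zero_iff_meromorphicOrderAt_eq_zero (hf z hz)]
    exact ⟨f z, by rw [hfz]; exact hw0, hcont.tendsto.mono_left nhdsWithin_le_nhds⟩
  obtain ⟨z₀, hz₀, hz₀K⟩ : ∃ z ∈ ball (0:ℂ) 1, z ∉ K := by
    by_contra! h
    have h1 : (1 : ℂ) ∈ closure (ball (0:ℂ) 1) := by
      rw [closure_ball _ one_ne_zero]; simp
    have h2 := hKb (hKc.isClosed.closure_subset_iff.mpr h h1)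
    simp at h2
  refine ⟨(hf.exists_meromorphicOrderAt_ne_top_iff_forall
    ⟨⟨0, by simp⟩, (convex_ball _ _).isPreconnected⟩).mp
      ⟨⟨z₀, hz₀⟩, by simp [hord z₀ hz₀ hz₀K]⟩, ?_⟩
  refine ((MeromorphicOn.divisor f K).finiteSupport hKc).subset fun z hz => ?_
  have hzb := (MeromorphicOn.divisor f (ball (0:ℂ) 1)).supportWithinDomain hz
  have hzK : z ∈ K := by
    by_contra h
    rw [Function.mem_support, MeromorphicOn.divisor_apply hf hzb, hord z hzb h] at hz
    simp at hz
  rw [Function.mem_support, MeromorphicOn.divisor_apply hf hzb] at hz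
  rwa [Function.mem_support, MeromorphicOn.divisor_apply (fun w hw => hf w (hKb hw)) hzK]

/-- A function meromorphic on the open unit disc, extending continuously to the closed disc
as a map `F` into the Riemann sphere, and unimodular on the unit circle, is a quotient of two
finite Blaschke products. -/
theorem meromorphic_unimodular_quotient_finite_blaschke
    (f : ℂ → ℂ) (F : ℂ → OnePoint ℂ)
    (hf : MeromorphicOn f (ball (0:ℂ) 1))
    (hF : ContinuousOn F (closedBall (0:ℂ) 1))
    (hagree : ∀ z ∈ ball (0:ℂ) 1, F z ≠ (∞ : OnePoint ℂ) → F z = (f z : OnePoint ℂ))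
    (hcirc : ∀ ζ ∈ sphere (0:ℂ) 1, ∃ w : ℂ, F ζ = (w : OnePoint ℂ) ∧ ‖w‖ = 1) :
    ∃ B₁ B₂ : ℂ → ℂ, IsFiniteBlaschkeOn B₁ (ball (0:ℂ) 1) ∧
      IsFiniteBlaschkeOn B₂ (ball (0:ℂ) 1) ∧
      ∀ z ∈ ball (0:ℂ) 1, F z ≠ (∞ : OnePoint ℂ) → f z * B₂ z = B₁ z := by
  obtain ⟨hord, hfin⟩ := order_ne_top_and_finite_divisor_support hf hF hagree hcirc
  obtain ⟨g, hg, hg0, hfg⟩ := hf.extract_zeros_poles hord hfin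
  set D := MeromorphicOn.divisor f (ball (0:ℂ) 1) with hD
  set S := hfin.toFinset with hSdef
  have hS : ∀ u ∈ S, ‖u‖ < 1 := fun u hu => by
    simpa using D.supportWithinDomain (hfin.mem_toFinset.mp hu)
  have hRat : ∀ z, (∏ᶠ u, (· - u) ^ D u : ℂ → ℂ) z = ∏ u ∈ S, (z - u) ^ D u := by
    intro z
    rw [finprod_eq_prod_of_mulSupport_subset (s := S)]
    · simp
    · rw [Function.FactorizedRational.mulSupport]
      simp [hSdef]
  set P := blaschkeProd S (fun u => (D u).toNat) with hP
  set Q := blaschkeProd S (fun u => (-D u).toNat) with hQ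
  set h : ℂ → ℂ := fun z => g z * ∏ u ∈ S, (-(1 - (starRingEnd ℂ) u * z)) ^ D u with hh
  have hq : ∀ u ∈ S, ∀ z ∈ ball (0:ℂ) 1, -(1 - (starRingEnd ℂ) u * z) ≠ 0 := fun u hu z hz =>
    neg_ne_zero.mpr (one_sub_conj_mul_ne_zero (hS u hu) (by simpa using (mem_ball.mp hz).le))
  have hh0 : ∀ z ∈ ball (0:ℂ) 1, h z ≠ 0 := fun z hz =>
    mul_ne_zero (hg0 ⟨z, hz⟩) (Finset.prod_ne_zero_iff.mpr fun u hu => zpow_ne_zero _ (hq u hu z hz))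
  have hhd : ∀ z ∈ ball (0:ℂ) 1, DifferentiableAt ℂ h z := by
    intro z hz
    refine (hg z hz).differentiableAt.mul (DifferentiableAt.fun_finsetProd fun u hu => ?_)
    exact DifferentiableAt.zpow (by fun_prop) (Or.inl (hq u hu z hz))
  have hkey : ∀ z ∈ ball (0:ℂ) 1, F z ≠ ∞ → f z * Q z = h z * P z := by
    intro z hz hFz
    have hnhds : ball (0:ℂ) 1 ∈ nhds z := isOpen_ball.mem_nhds hz
    have hz1 : ‖z‖ ≤ 1 := by simpa using (mem_ball.mp hz).le
    have hcont : ContinuousAt f z := continuousAt_of_continuousAt_onePoint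
      (hF.continuousAt (Filter.mem_of_superset hnhds ball_subset_closedBall)) hFz
      (Filter.eventually_of_mem hnhds hagree)
    refine tendsto_nhds_unique_of_eventuallyEq (l := nhdsWithin z {z}ᶜ)
      ((hcont.mul (continuousAt_blaschkeProd hS _ hz1)).tendsto.mono_left nhdsWithin_le_nhds)
      (((hhd z hz).continuousAt.mul
        (continuousAt_blaschkeProd hS _ hz1)).tendsto.mono_left nhdsWithin_le_nhds) ?_
    have hSfar : (↑S \ {z} : Set ℂ)ᶜ ∈ nhds z :=
      (S.finite_toSet.subset sdiff_subset).isClosed.isOpen_compl.mem_nhds (by simp)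
    filter_upwards [mem_codiscreteWithin_iff_forall_mem_nhdsNE.mp hfg z hz,
      mem_nhdsWithin_of_mem_nhds hnhds, mem_nhdsWithin_of_mem_nhds hSfar,
      self_mem_nhdsWithin] with w hw hwb hwS hwz
    have hwS' : w ∉ S := fun hc => hwS ⟨hc, hwz⟩
    have hfw : f w = (∏ u ∈ S, (w - u) ^ D u) * g w := by
      rcases hw with hw | hw
      · rw [← hRat]; exact hw
      · exact absurd hwb hw
    have := prod_zpow_mul_blaschkeProd hS D (by simpa using (mem_ball.mp hwb).le) hwS'
    simp only [Pi.mul_apply, hfw, hh]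
    linear_combination g w * this
  set φ : ℂ → ℂ := fun z => (F z).elim 0 id with hφ
  classical
  set H : ℂ → ℂ := fun z => if z ∈ ball (0:ℂ) 1 then h z else φ z * Q z / P z with hH
  have hHh : ∀ z ∈ ball (0:ℂ) 1, H z = h z := fun z hz => if_pos hz
  have hHs : ∀ z ∈ sphere (0:ℂ) 1, H z = φ z * Q z / P z := fun z hz =>
    if_neg (fun hb => by simp_all)
  have hHcont : ContinuousOn H (closedBall 0 1) := by
    intro z hz
    rw [← ball_union_sphere] at hz
    rcases hz with hz | hz
    · refine (((hhd z hz).continuousAt).congr ?_).continuousWithinAt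
      exact Filter.eventually_of_mem (isOpen_ball.mem_nhds hz) fun w hw => (hHh w hw).symm
    · have hz1 : ‖z‖ = 1 := by simpa using hz
      have hP0 : P z ≠ 0 := norm_ne_zero_iff.mp
        (by rw [hP, norm_blaschkeProd_eq_one hS _ hz1]; exact one_ne_zero)
      have hPc : ContinuousAt P z := continuousAt_blaschkeProd hS _ hz1.le
      have hQc : ContinuousAt Q z := continuousAt_blaschkeProd hS _ hz1.le
      obtain ⟨v, hv, -⟩ := hcirc z hz
      have hFc : ContinuousWithinAt F (closedBall 0 1) z := hF z (sphere_subset_closedBall hz)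
      have hφc : ContinuousWithinAt φ (closedBall 0 1) z :=
        ContinuousAt.comp_continuousWithinAt (g := fun p : OnePoint ℂ => p.elim 0 id)
          (by rw [hv]; exact continuousAt_onePoint_elim v) hFc
      refine ((hφc.mul hQc.continuousWithinAt).div
        hPc.continuousWithinAt hP0).congr_of_eventuallyEq ?_ (hHs z hz)
      have hFne : ∀ᶠ w in nhdsWithin z (closedBall 0 1), F w ≠ ∞ :=
        hFc.eventually_ne (by rw [hv]; exact coe_ne_infty v)
      filter_upwards [hFne, mem_nhdsWithin_of_mem_nhds (hPc.eventually_ne hP0)] with w hw hPw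
      by_cases hwb : w ∈ ball (0:ℂ) 1
      · have hφw : φ w = f w := by simp [hφ, hagree w hwb hw]
        rw [hHh w hwb]
        change h w = φ w * Q w / P w
        rw [hφw, hkey w hwb hw, mul_div_cancel_right₀ _ hPw]
      · exact if_neg hwb
  have hHd : DiffContOnCl ℂ H (ball 0 1) :=
    ⟨fun z hz => ((hhd z hz).congr_of_eventuallyEq (Filter.eventually_of_mem
        (isOpen_ball.mem_nhds hz) hHh)).differentiableWithinAt,
      by rwa [closure_ball _ one_ne_zero]⟩
  obtain ⟨c, hc, hHc⟩ := exists_eqOn_const_of_norm_eq_one_on_sphere hHd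
    (fun z hz => by rw [hHh z hz]; exact hh0 z hz) (fun z hz => by
      have hz1 : ‖z‖ = 1 := by simpa using hz
      obtain ⟨v, hv, hv1⟩ := hcirc z hz
      have hφz : φ z = v := by simp [hφ, hv]
      rw [hHs z hz, norm_div, norm_mul, hP, hQ, norm_blaschkeProd_eq_one hS _ hz1,
        norm_blaschkeProd_eq_one hS _ hz1, hφz, hv1]
      simp)
  refine ⟨fun z => c * P z, Q, (IsFiniteBlaschkeOn.const hc _).mul (.prod hS _ _),
    .prod hS _ _, fun z hz hFz => ?_⟩
  rw [hkey z hz hFz, ← hHh z hz, hHc z hz]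
end

section
/- (Carathéodory) Let f be holomorphic on the open unit disc 𝔻 with |f(z)| ≤ 1 for all z ∈ 𝔻. Then for every integer n ≥ 1 there exists a finite Blaschke product B_n such that |f(z) − B_n(z)| ≤ 2|z|^n for all z ∈ 𝔻; in particular, there is a sequence of finite Blaschke products converging to f uniformly on every compact subset of 𝔻. -/
open Complex Metric Set Filter

open Polynomial in
/-- Every nonzero polynomial is a product of linear factors with roots in the open unit disc and
a polynomial without zeros there. -/
theorem Polynomial.exists_eq_prod_mul_of_ne_zero (p : ℂ[X]) (hp : p ≠ 0) :
    ∃ (m : ℕ) (a : Fin m → ℂ) (r : ℂ[X]), (∀ k, ‖a k‖ < 1) ∧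
      (∀ z ∈ ball (0 : ℂ) 1, r.eval z ≠ 0) ∧ p = (∏ k, (C (a k) - X)) * r := by
  induction hd : p.natDegree using Nat.strong_induction_on generalizing p with
  | _ d ih =>
    by_cases h : ∃ z ∈ ball (0 : ℂ) 1, p.eval z = 0
    · obtain ⟨z, hz, hpz⟩ := h
      obtain ⟨p₁, rfl⟩ := dvd_iff_isRoot.mpr hpz
      have hp₁ : p₁ ≠ 0 := right_ne_zero_of_mul hp
      have hdeg : p₁.natDegree < d := by
        rw [← hd, natDegree_mul (X_sub_C_ne_zero z) hp₁, natDegree_X_sub_C]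
        omega
      obtain ⟨m, a, r, ha, hr, h⟩ := ih _ hdeg p₁ hp₁ rfl
      refine ⟨m + 1, Fin.cons z a, -r, ?_, ?_, ?_⟩
      · intro k
        refine Fin.cases ?_ (fun i => ?_) k
        · simpa using hz
        · simpa using ha i
      · intro w hw
        simpa using hr w hw
      · rw [Fin.prod_univ_succ, h]
        simp only [Fin.cons_zero, Fin.cons_succ]
        ring
    · push Not at h
      exact ⟨0, Fin.elim0, p, fun k => k.elim0, h, by simp⟩

theorem one_sub_conj_mul_ne_zero_s3 {a w : ℂ} (ha : ‖a‖ < 1) (hw : ‖w‖ ≤ 1) :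
    1 - (starRingEnd ℂ) a * w ≠ 0 := by
  intro h
  have h1 : ‖(starRingEnd ℂ) a * w‖ = 1 := by rw [← sub_eq_zero.mp h, norm_one]
  rw [norm_mul, RCLike.norm_conj] at h1
  nlinarith [norm_nonneg a, norm_nonneg w]

theorem norm_conj_mul_sub_sq_sub (a u w : ℂ) :
    ‖u - (starRingEnd ℂ) a * w‖ ^ 2 - ‖a * u - w‖ ^ 2 =
      (1 - ‖a‖ ^ 2) * (‖u‖ ^ 2 - ‖w‖ ^ 2) := by
  simp only [← Complex.normSq_eq_norm_sq, Complex.normSq_apply]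
  simp
  ring

theorem norm_div_one_sub_conj_mul_le_one {a w : ℂ} (ha : ‖a‖ < 1) (hw : ‖w‖ ≤ 1) :
    ‖(a - w) / (1 - (starRingEnd ℂ) a * w)‖ ≤ 1 := by
  rw [norm_div]
  refine div_le_one_of_le₀ ?_ (norm_nonneg _)
  have h := norm_conj_mul_sub_sq_sub a 1 w
  rw [mul_one, norm_one] at h
  have h2 : 0 ≤ (1 - ‖a‖ ^ 2) * (1 ^ 2 - ‖w‖ ^ 2) := by
    apply mul_nonneg <;> nlinarith [norm_nonneg a, norm_nonneg w]
  exact le_of_sq_le_sq (by linarith) (norm_nonneg _)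

theorem norm_moebius_sub_moebius_le {a v w : ℂ} (ha : ‖a‖ < 1) (hv : ‖v‖ ≤ 1) (hw : ‖w‖ ≤ 1) :
    ‖(a - v) / (1 - (starRingEnd ℂ) a * v) - (a - w) / (1 - (starRingEnd ℂ) a * w)‖ ≤
      ‖v - w‖ / (1 - ‖a‖) ^ 2 := by
  have key : ∀ x : ℂ, ‖x‖ ≤ 1 → 1 - ‖a‖ ≤ ‖1 - (starRingEnd ℂ) a * x‖ := by
    intro x hx
    have h1 := norm_sub_norm_le 1 ((starRingEnd ℂ) a * x)
    rw [norm_mul, RCLike.norm_conj, norm_one] at h1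
    nlinarith [norm_nonneg a]
  have h1 : (a - v) / (1 - (starRingEnd ℂ) a * v) - (a - w) / (1 - (starRingEnd ℂ) a * w) =
      ((starRingEnd ℂ) a * a - 1) * (v - w) /
        ((1 - (starRingEnd ℂ) a * v) * (1 - (starRingEnd ℂ) a * w)) := by
    rw [div_sub_div _ _ (one_sub_conj_mul_ne_zero_s3 ha hv) (one_sub_conj_mul_ne_zero_s3 ha hw)]
    ring
  have h2 : ‖(starRingEnd ℂ) a * a - 1‖ ≤ 1 := by
    rw [Complex.conj_mul', ← Complex.ofReal_pow, ← Complex.ofReal_one, ← Complex.ofReal_sub,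
      Complex.norm_real, Real.norm_eq_abs, abs_le]
    constructor <;> nlinarith [norm_nonneg a]
  have h3 : 0 < 1 - ‖a‖ := by linarith
  rw [h1, norm_div, norm_mul, norm_mul, pow_two]
  gcongr
  · exact mul_le_of_le_one_left (norm_nonneg _) h2
  · exact key v hv
  · exact key w hw

open Polynomial in
/-- The quotient `p / q` has no poles in the closed unit disc and is unimodular on the circle. -/
def IsUnimodularQuotient (p q : ℂ[X]) : Prop :=
  (∀ z ∈ closedBall (0 : ℂ) 1, q.eval z ≠ 0) ∧
    ∀ z ∈ sphere (0 : ℂ) 1, ‖p.eval z‖ = ‖q.eval z‖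

namespace IsUnimodularQuotient

open Polynomial

variable {p q : ℂ[X]}

theorem diffContOnCl (h : IsUnimodularQuotient p q) :
    DiffContOnCl ℂ (fun z => p.eval z / q.eval z) (ball (0 : ℂ) 1) := by
  apply DifferentiableOn.diffContOnCl
  rw [closure_ball _ one_ne_zero]
  exact p.differentiable.differentiableOn.fun_div q.differentiable.differentiableOn h.1

theorem norm_le_one (h : IsUnimodularQuotient p q) {z : ℂ} (hz : z ∈ closedBall (0 : ℂ) 1) :
    ‖p.eval z / q.eval z‖ ≤ 1 := by
  refine Complex.norm_le_of_forall_mem_frontier_norm_le isBounded_ball h.diffContOnCl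
    (fun w hw => ?_) (by rwa [closure_ball _ one_ne_zero])
  rw [frontier_ball _ one_ne_zero] at hw
  rw [norm_div, h.2 w hw]
  exact div_self_le_one _

theorem exists_eq_const_of_forall_ne_zero (h : IsUnimodularQuotient p q)
    (hp : ∀ z ∈ ball (0 : ℂ) 1, p.eval z ≠ 0) :
    ∃ c : ℂ, ‖c‖ = 1 ∧ ∀ z ∈ ball (0 : ℂ) 1, p.eval z / q.eval z = c := by
  have h' : IsUnimodularQuotient q p := by
    refine ⟨fun z hz => ?_, fun z hz => (h.2 z hz).symm⟩
    rw [← ball_union_sphere] at hz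
    rcases hz with hz | hz
    · exact hp z hz
    · rw [← norm_ne_zero_iff, h.2 z hz, norm_ne_zero_iff]
      exact h.1 z (sphere_subset_closedBall hz)
  have hnorm : ∀ z ∈ ball (0 : ℂ) 1, ‖p.eval z / q.eval z‖ = 1 := by
    intro z hz
    have hz' := ball_subset_closedBall hz
    refine le_antisymm (h.norm_le_one hz') ?_
    have h1 := h'.norm_le_one hz'
    rw [← inv_div, norm_inv] at h1
    refine (inv_le_one₀ (norm_pos_iff.mpr (div_ne_zero (hp z hz) (h.1 z hz')))).mp h1
  have h0 : (0 : ℂ) ∈ ball (0 : ℂ) 1 := mem_ball_self one_pos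
  refine ⟨p.eval 0 / q.eval 0, hnorm 0 h0, fun z hz => ?_⟩
  refine Complex.eqOn_of_isPreconnected_of_isMaxOn_norm (convex_ball _ _).isPreconnected
    isOpen_ball h.diffContOnCl.differentiableOn h0 (fun w hw => ?_) hz
  simp only [mem_ofPred_eq, Function.comp_apply]
  rw [hnorm w hw, hnorm 0 h0]

theorem isFiniteBlaschkeOn (h : IsUnimodularQuotient p q) :
    IsFiniteBlaschkeOn (fun z => p.eval z / q.eval z) (ball (0 : ℂ) 1) := by
  have hp : p ≠ 0 := by
    rintro rfl
    have h1 := h.2 1 (by simp)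
    rw [eval_zero, norm_zero] at h1
    exact h.1 1 (by simp) (norm_eq_zero.mp h1.symm)
  obtain ⟨m, a, r, ha, hr, rfl⟩ := p.exists_eq_prod_mul_of_ne_zero hp
  have hne : ∀ z ∈ ball (0 : ℂ) 1, ∀ k, 1 - (starRingEnd ℂ) (a k) * z ≠ 0 := fun z hz k =>
    one_sub_conj_mul_ne_zero_s3 (ha k) (mem_ball_zero_iff.mp hz).le
  have h' : IsUnimodularQuotient ((∏ k, (1 - C ((starRingEnd ℂ) (a k)) * X)) * r) q := by
    refine ⟨h.1, fun z hz => ?_⟩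
    rw [← h.2 z hz]
    simp only [eval_mul, eval_prod, eval_sub, eval_C, eval_X, eval_one, norm_mul, norm_prod]
    congr 1
    refine Finset.prod_congr rfl fun k _ => ?_
    have h1 := norm_conj_mul_sub_sq_sub (a k) 1 z
    rw [mul_one, mem_sphere_zero_iff_norm.mp hz, norm_one, sub_self, mul_zero] at h1
    exact (sq_eq_sq₀ (norm_nonneg _) (norm_nonneg _)).mp (by linarith)
  obtain ⟨c, hc, hcz⟩ := h'.exists_eq_const_of_forall_ne_zero fun z hz => by
    simp only [eval_mul, eval_prod, eval_sub, eval_C, eval_X, eval_one]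
    exact mul_ne_zero (Finset.prod_ne_zero_iff.mpr fun k _ => hne z hz k) (hr z hz)
  refine ⟨m, c, a, hc, ha, fun z hz => ?_⟩
  have hprod : ∏ k, (1 - (starRingEnd ℂ) (a k) * z) ≠ 0 :=
    Finset.prod_ne_zero_iff.mpr fun k _ => hne z hz k
  have hqz := h.1 z (ball_subset_closedBall hz)
  rw [finBlaschke, ← hcz z hz, Finset.prod_div_distrib]
  simp only [eval_mul, eval_prod, eval_sub, eval_C, eval_X, eval_one]
  rw [mul_div_assoc', eq_div_iff hprod]
  ring

/-- The Möbius image of `X * (p / q)`. -/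
theorem moebius (h : IsUnimodularQuotient p q) {a : ℂ} (ha : ‖a‖ < 1) :
    IsUnimodularQuotient (C a * q - X * p) (q - C ((starRingEnd ℂ) a) * (X * p)) := by
  refine ⟨fun z hz => ?_, fun z hz => ?_⟩
  · have hq := h.1 z hz
    have h1 : (q - C ((starRingEnd ℂ) a) * (X * p)).eval z =
        q.eval z * (1 - (starRingEnd ℂ) a * (z * (p.eval z / q.eval z))) := by
      simp only [eval_mul, eval_sub, eval_C, eval_X]
      field_simp
    rw [h1]
    refine mul_ne_zero hq (one_sub_conj_mul_ne_zero_s3 ha ?_)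
    rw [norm_mul]
    exact mul_le_one₀ (mem_closedBall_zero_iff.mp hz) (norm_nonneg _) (h.norm_le_one hz)
  · have h1 := norm_conj_mul_sub_sq_sub a (q.eval z) (z * p.eval z)
    rw [norm_mul z, mem_sphere_zero_iff_norm.mp hz, one_mul, h.2 z hz, sub_self, mul_zero] at h1
    simp only [eval_mul, eval_sub, eval_C, eval_X]
    exact (sq_eq_sq₀ (norm_nonneg _) (norm_nonneg _)).mp (by linarith)

end IsUnimodularQuotient

/-- One step of the Schur algorithm. -/
theorem exists_eq_moebius_of_norm_le_one {f : ℂ → ℂ} (hf : DifferentiableOn ℂ f (ball (0 : ℂ) 1))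
    (hb : ∀ z ∈ ball (0 : ℂ) 1, ‖f z‖ ≤ 1) {a : ℂ} (hfa : f 0 = a) (ha : ‖a‖ < 1) :
    ∃ h : ℂ → ℂ, DifferentiableOn ℂ h (ball (0 : ℂ) 1) ∧ (∀ z ∈ ball (0 : ℂ) 1, ‖h z‖ ≤ 1) ∧
      ∀ z ∈ ball (0 : ℂ) 1, f z = (a - z * h z) / (1 - (starRingEnd ℂ) a * (z * h z)) := by
  set g : ℂ → ℂ := fun z => (a - f z) / (1 - (starRingEnd ℂ) a * f z) with hg
  have hg0 : g 0 = 0 := by simp [hg, hfa]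
  have hgd : DifferentiableOn ℂ g (ball (0 : ℂ) 1) :=
    (hf.const_sub a).fun_div ((hf.const_mul _).const_sub 1)
      fun z hz => one_sub_conj_mul_ne_zero_s3 ha (hb z hz)
  have hgb : ∀ z ∈ ball (0 : ℂ) 1, ‖g z‖ ≤ 1 := fun z hz =>
    norm_div_one_sub_conj_mul_le_one ha (hb z hz)
  refine ⟨dslope g 0, ?_, fun z hz => ?_, fun z hz => ?_⟩
  · exact (Complex.differentiableOn_dslope (ball_mem_nhds 0 one_pos)).mpr hgd
  · simpa using Complex.norm_dslope_le_div_of_mapsTo_ball (R₂ := 1) hgd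
      (fun w hw => by rw [hg0]; simpa using hgb w hw) hz
  · have h1 : z * dslope g 0 z = g z := by
      simpa [hg0] using sub_smul_dslope g 0 z
    have hne := one_sub_conj_mul_ne_zero_s3 ha (hb z hz)
    have hne' := one_sub_conj_mul_ne_zero_s3 ha (hgb z hz)
    have h2 : g z * (1 - (starRingEnd ℂ) a * f z) = a - f z := div_mul_cancel₀ _ hne
    rw [h1, eq_div_iff hne']
    linear_combination h2

theorem exists_isUnimodularQuotient_norm_sub_le (n : ℕ) {f : ℂ → ℂ}
    (hf : DifferentiableOn ℂ f (ball (0 : ℂ) 1)) (hb : ∀ z ∈ ball (0 : ℂ) 1, ‖f z‖ ≤ 1) :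
    ∃ p q : Polynomial ℂ, IsUnimodularQuotient p q ∧
      ∀ z ∈ ball (0 : ℂ) 1, ‖f z - p.eval z / q.eval z‖ ≤ 2 * ‖z‖ ^ n := by
  induction n generalizing f with
  | zero =>
    refine ⟨1, 1, ⟨by simp, by simp⟩, fun z hz => ?_⟩
    have h1 := norm_sub_le (f z) 1
    have h2 := hb z hz
    rw [norm_one] at h1
    simp only [Polynomial.eval_one, div_one, pow_zero, mul_one]
    linarith
  | succ n ih =>
    have h0 : (0 : ℂ) ∈ ball (0 : ℂ) 1 := mem_ball_self one_pos
    rcases (hb 0 h0).lt_or_eq with ha | ha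
    · obtain ⟨h, hhd, hhb, hfh⟩ := exists_eq_moebius_of_norm_le_one hf hb rfl ha
      obtain ⟨p, q, hpq, hle⟩ := ih hhd hhb
      refine ⟨_, _, hpq.moebius ha, ?_⟩
      set B : ℂ → ℂ := fun z => (Polynomial.C (f 0) * q - Polynomial.X * p).eval z /
        (q - Polynomial.C ((starRingEnd ℂ) (f 0)) * (Polynomial.X * p)).eval z with hB
      have hBd : DifferentiableOn ℂ B (ball (0 : ℂ) 1) :=
        (hpq.moebius ha).diffContOnCl.differentiableOn
      have hBb : ∀ z ∈ ball (0 : ℂ) 1, ‖B z‖ ≤ 1 := fun z hz =>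
        (hpq.moebius ha).norm_le_one (ball_subset_closedBall hz)
      have hBz : ∀ z ∈ ball (0 : ℂ) 1, B z = (f 0 - z * (p.eval z / q.eval z)) /
          (1 - (starRingEnd ℂ) (f 0) * (z * (p.eval z / q.eval z))) := by
        intro z hz
        have hq := hpq.1 z (ball_subset_closedBall hz)
        rw [← mul_div_mul_left _ _ hq]
        simp only [hB, Polynomial.eval_mul, Polynomial.eval_sub, Polynomial.eval_C,
          Polynomial.eval_X]
        congr 1 <;> field_simp
      have hbound : ∀ z ∈ ball (0 : ℂ) 1,
          ‖f z - B z‖ ≤ 2 / (1 - ‖f 0‖) ^ 2 * ‖z ^ (n + 1)‖ := by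
        intro z hz
        have hz1 : ‖z‖ ≤ 1 := (mem_ball_zero_iff.mp hz).le
        rw [hfh z hz, hBz z hz]
        refine (norm_moebius_sub_moebius_le ha ?_ ?_).trans ?_
        · rw [norm_mul]
          exact mul_le_one₀ hz1 (norm_nonneg _) (hhb z hz)
        · rw [norm_mul]
          exact mul_le_one₀ hz1 (norm_nonneg _) (hpq.norm_le_one (ball_subset_closedBall hz))
        · rw [← mul_sub, norm_mul, div_mul_eq_mul_div, norm_pow]
          refine div_le_div_of_nonneg_right ?_ (sq_nonneg _)
          calc _ ≤ ‖z‖ * (2 * ‖z‖ ^ n) := by gcongr; exact hle z hz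
            _ = 2 * ‖z‖ ^ (n + 1) := by ring
      have h0B : f 0 - B 0 = 0 := by simpa using hbound 0 h0
      have hO : (fun z => f z - B z) =O[nhds 0] fun z => z ^ (n + 1) :=
        Asymptotics.IsBigO.of_bound _ (Filter.eventually_of_mem (ball_mem_nhds 0 one_pos) hbound)
      have ho : (fun z => f z - B z) =o[nhds 0] fun z => z ^ n :=
        hO.trans_isLittleO (Asymptotics.isLittleO_pow_pow n.lt_succ_self)
      intro z hz
      have hS := Complex.dist_le_mul_div_pow_of_mapsTo_ball_of_isLittleO (n := n) (R₂ := 2)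
        (f := fun z => f z - B z) (hf.sub hBd) ?_ ?_ hz
      · simpa only [h0B, dist_zero_right, div_one] using hS
      · intro w hw
        have h1 := norm_sub_le (f w) (B w)
        have h2 := hb w hw
        have h3 := hBb w hw
        simp only [h0B, mem_closedBall_zero_iff]
        linarith
      · simpa [h0B] using ho.norm_right
    · refine ⟨Polynomial.C (f 0), 1, ⟨by simp, by simp [ha]⟩, fun z hz => ?_⟩
      have h1 : f z = f 0 :=
        Complex.eqOn_of_isPreconnected_of_isMaxOn_norm (convex_ball _ _).isPreconnected
          isOpen_ball hf h0 (fun w hw => by simpa [ha] using hb w hw) hz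
      simp only [h1, Polynomial.eval_C, Polynomial.eval_one, div_one, sub_self, norm_zero]
      positivity

/-- **Carathéodory's theorem.** Every function in the closed unit ball of `H^∞` admits, for each
`n ≥ 1`, a finite Blaschke product `B` with `|f(z) - B(z)| ≤ 2|z|^n` on the disc; in particular,
there is a sequence of finite Blaschke products converging to `f` uniformly on compact subsets of
the open unit disc. -/
theorem caratheodory_finite_blaschke (f : ℂ → ℂ)
    (hf : DifferentiableOn ℂ f (ball (0:ℂ) 1))
    (hb : ∀ z ∈ ball (0:ℂ) 1, ‖f z‖ ≤ 1) :
    (∀ n : ℕ, 1 ≤ n → ∃ B : ℂ → ℂ, IsFiniteBlaschkeOn B (ball (0:ℂ) 1) ∧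
      ∀ z ∈ ball (0:ℂ) 1, ‖f z - B z‖ ≤ 2 * ‖z‖ ^ n) ∧
    ∃ B : ℕ → ℂ → ℂ, (∀ n, IsFiniteBlaschkeOn (B n) (ball (0:ℂ) 1)) ∧
      TendstoLocallyUniformlyOn B f atTop (ball (0:ℂ) 1) := by
  have key : ∀ n : ℕ, ∃ B : ℂ → ℂ, IsFiniteBlaschkeOn B (ball (0:ℂ) 1) ∧
      ∀ z ∈ ball (0:ℂ) 1, ‖f z - B z‖ ≤ 2 * ‖z‖ ^ n := by
    intro n
    obtain ⟨p, q, hpq, hle⟩ := exists_isUnimodularQuotient_norm_sub_le n hf hb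
    exact ⟨_, hpq.isFiniteBlaschkeOn, hle⟩
  refine ⟨fun n _ => key n, ?_⟩
  choose B hB hle using key
  refine ⟨B, hB, ?_⟩
  rw [tendstoLocallyUniformlyOn_iff_forall_isCompact isOpen_ball]
  intro K hK hKc
  obtain ⟨r, hr0, hr1, hr⟩ : ∃ r : ℝ, 0 ≤ r ∧ r < 1 ∧ ∀ z ∈ K, ‖z‖ ≤ r := by
    rcases K.eq_empty_or_nonempty with rfl | hne
    · exact ⟨0, le_rfl, one_pos, by simp⟩
    · obtain ⟨w, hw, hmax⟩ := hKc.exists_isMaxOn hne continuous_norm.continuousOn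
      exact ⟨‖w‖, norm_nonneg w, mem_ball_zero_iff.mp (hK hw), fun z hz => hmax hz⟩
  rw [Metric.tendstoUniformlyOn_iff]
  intro ε hε
  have hlim : Tendsto (fun n : ℕ => 2 * r ^ n) atTop (nhds 0) := by
    simpa using (tendsto_pow_atTop_nhds_zero_of_lt_one hr0 hr1).const_mul 2
  filter_upwards [hlim.eventually_lt_const hε] with n hn z hz
  rw [dist_eq_norm]
  refine (hle n z (hK hz)).trans_lt (lt_of_le_of_lt ?_ hn)
  gcongr
  exact hr z hz
end

section
/- (Fisher) Let f be continuous on the closed unit disc, holomorphic on the open unit disc 𝔻, with |f(z)| ≤ 1 for all z in the closed unit disc, and let ε > 0. Then there exist finite Blaschke products B₁, …, B_n and nonnegative reals λ₁, …, λ_n with λ₁ + ⋯ + λ_n = 1 such that sup_{z ∈ 𝔻} |λ₁B₁(z) + ⋯ + λ_nB_n(z) − f(z)| < ε. Consequently, the closed convex hull of the finite Blaschke products in the supremum norm is the closed unit ball of the disc algebra. -/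
open Complex Metric Set

/-- The reciprocal polynomial `z ^ n * conj (p (1 / conj z))`, written out as a sum. -/
noncomputable def conjReciprocal (p : Polynomial ℂ) (n : ℕ) (z : ℂ) : ℂ :=
  ∑ k ∈ Finset.range n, (starRingEnd ℂ) (p.coeff k) * z ^ (n - k)

theorem conjReciprocal_eq {p : Polynomial ℂ} {n : ℕ} (hp : p.natDegree < n) {z : ℂ}
    (hz : z ≠ 0) :
    conjReciprocal p n z =
      z ^ n * (starRingEnd ℂ) (p.eval ((starRingEnd ℂ) z)⁻¹) := by
  rw [Polynomial.eval_eq_sum_range' hp, map_sum, Finset.mul_sum]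
  refine Finset.sum_congr rfl fun k hk => ?_
  have hk' : k ≤ n := (Finset.mem_range.mp hk).le
  rw [map_mul, map_pow, map_inv₀, Complex.conj_conj, pow_sub₀ _ hz hk', inv_pow]
  ring

theorem conjReciprocal_zero (p : Polynomial ℂ) (n : ℕ) : conjReciprocal p n 0 = 0 := by
  refine Finset.sum_eq_zero fun k hk => ?_
  have : n - k ≠ 0 := by have := Finset.mem_range.mp hk; omega
  simp [this]

theorem norm_conjReciprocal_le {p : Polynomial ℂ} {n : ℕ} (hp : p.natDegree < n) {ρ : ℝ}
    (hρ : ∀ z ∈ closedBall (0 : ℂ) 1, ‖p.eval z‖ ≤ ρ) {z : ℂ} (hz : z ∈ closedBall (0 : ℂ) 1) :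
    ‖conjReciprocal p n z‖ ≤ ρ := by
  have hdiff : Differentiable ℂ (conjReciprocal p n) := by
    unfold conjReciprocal
    fun_prop
  have hcl : closure (ball (0 : ℂ) 1) = closedBall 0 1 := closure_ball 0 one_ne_zero
  refine Complex.norm_le_of_forall_mem_frontier_norm_le (U := ball (0 : ℂ) 1) isBounded_ball
    hdiff.diffContOnCl (fun w hw => ?_) (hcl ▸ hz)
  rw [frontier_ball 0 one_ne_zero, mem_sphere_zero_iff_norm] at hw
  have hw0 : w ≠ 0 := by
    rintro rfl
    simp at hw
  rw [conjReciprocal_eq hp hw0, norm_mul, norm_pow, hw, one_pow, one_mul, RCLike.norm_conj]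
  exact hρ _ (by simp [hw])

/-- If `‖p‖ ≤ ρ < 1` on the closed disc and `w` is unimodular, then
`(p + w z ^ n) / (1 + w p^*)` is a finite Blaschke product. -/
theorem isFiniteBlaschkeOn_add_div {p : Polynomial ℂ} {n : ℕ} (hp : p.natDegree < n) {ρ : ℝ}
    (hρ1 : ρ < 1) (hρ : ∀ z ∈ closedBall (0 : ℂ) 1, ‖p.eval z‖ ≤ ρ) {w : ℂ} (hw : ‖w‖ = 1) :
    IsFiniteBlaschkeOn (fun z => (p.eval z + w * z ^ n) / (1 + w * conjReciprocal p n z))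
      (ball (0 : ℂ) 1) := by
  have hw0 : w ≠ 0 := by
    rintro rfl
    simp at hw
  have hww : w * (starRingEnd ℂ) w = 1 := by
    rw [Complex.mul_conj, Complex.normSq_eq_norm_sq, hw]; simp
  set P : Polynomial ℂ := p + Polynomial.C w * Polynomial.X ^ n with hP
  have hdlt : p.degree < (Polynomial.C w * Polynomial.X ^ n).degree := by
    rw [Polynomial.degree_C_mul_X_pow n hw0]
    exact (Polynomial.degree_le_natDegree).trans_lt (by exact_mod_cast hp)
  have hdeg : P.natDegree = n := by
    rw [hP, Polynomial.natDegree_add_eq_right_of_degree_lt hdlt,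
      Polynomial.natDegree_C_mul_X_pow n w hw0]
  have hlead : P.leadingCoeff = w := by
    rw [hP, Polynomial.leadingCoeff_add_of_degree_lt hdlt, Polynomial.leadingCoeff_C_mul_X_pow]
  have hPeval (z : ℂ) : P.eval z = p.eval z + w * z ^ n := by simp [hP]
  have hsplit : P.Splits := IsAlgClosed.splits P
  have hcard : P.roots.toList.length = n := by
    rw [Multiset.length_toList, ← hdeg, hsplit.natDegree_eq_card_roots]
  obtain ⟨a, ha⟩ : ∃ a : Fin n → ℂ, List.ofFn a = P.roots.toList :=
    ⟨fun k => P.roots.toList.get (k.cast hcard.symm),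
      List.ext_getElem (by rw [List.length_ofFn, hcard]) (by simp)⟩
  have hprod (z : ℂ) : p.eval z + w * z ^ n = w * ∏ k, (z - a k) := by
    rw [← hPeval, hsplit.eval_eq_prod_roots, hlead]
    congr 1
    rw [← List.prod_ofFn, ← Function.comp_def (fun x => z - x) a, ← List.map_ofFn, ha,
      ← Multiset.prod_coe, ← Multiset.map_coe, Multiset.coe_toList]
  have hrecip (z : ℂ) :
      1 + w * conjReciprocal p n z = ∏ k, (1 - (starRingEnd ℂ) (a k) * z) := by
    rcases eq_or_ne z 0 with rfl | hz
    · simp [conjReciprocal_zero]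
    have hz' : (starRingEnd ℂ) z ≠ 0 := by simpa using hz
    have key := congrArg (starRingEnd ℂ) (hprod ((starRingEnd ℂ) z)⁻¹)
    simp only [map_add, map_mul, map_pow, map_inv₀, Complex.conj_conj, map_prod, map_sub] at key
    rw [conjReciprocal_eq hp hz]
    have h1 : ∏ k, (1 - (starRingEnd ℂ) (a k) * z)
        = z ^ n * ∏ k, (z⁻¹ - (starRingEnd ℂ) (a k)) := by
      rw [← Fin.prod_const, ← Finset.prod_mul_distrib]
      refine Finset.prod_congr rfl fun k _ => ?_
      field_simp
    have hzn : z ^ n * z⁻¹ ^ n = 1 := by rw [← mul_pow, mul_inv_cancel₀ hz, one_pow]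
    rw [h1]
    linear_combination (w * z ^ n) * key - (w * (starRingEnd ℂ) w) * hzn
      + (z ^ n * ∏ k, (z⁻¹ - (starRingEnd ℂ) (a k)) - 1) * hww
  have hden {z : ℂ} (hz : z ∈ closedBall (0 : ℂ) 1) : 1 + w * conjReciprocal p n z ≠ 0 := by
    intro h
    have h2 : ‖w * conjReciprocal p n z‖ ≤ ρ := by
      rw [norm_mul, hw, one_mul]
      exact norm_conjReciprocal_le hp hρ hz
    rw [← neg_eq_of_add_eq_zero_right h, norm_neg, norm_one] at h2
    linarith
  refine ⟨n, w * (-1) ^ n, a, by simp [hw], fun k => ?_, fun z _ => ?_⟩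
  · by_contra! hk
    have hk0 : a k ≠ 0 := by
      intro h
      rw [h, norm_zero] at hk
      linarith
    refine hden (z := ((starRingEnd ℂ) (a k))⁻¹) ?_ ?_
    · rw [mem_closedBall_zero_iff, norm_inv, RCLike.norm_conj]
      exact inv_le_one_of_one_le₀ hk
    · rw [hrecip]
      refine Finset.prod_eq_zero (Finset.mem_univ k) ?_
      rw [mul_inv_cancel₀ (by simpa using hk0), sub_self]
  · have h1 : ∏ k, (z - a k) = (-1) ^ n * ∏ k, (a k - z) := by
      rw [← Fin.prod_const, ← Finset.prod_mul_distrib]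
      exact Finset.prod_congr rfl fun k _ => by ring
    simp only [finBlaschke]
    rw [hprod, hrecip, h1, Finset.prod_div_distrib]
    ring

/-- Averaging `ω / (1 + ω s)` over the roots of unity `ω` of order `m + 1`. -/
theorem sum_rootsOfUnity_div {m : ℕ} {ζ : ℂ} (hζ : IsPrimitiveRoot ζ (m + 1)) {s : ℂ}
    (hs : ‖s‖ < 1) :
    ∑ j : Fin (m + 1), ζ ^ (j : ℕ) / (1 + ζ ^ (j : ℕ) * s)
      = (m + 1) * ((-s) ^ m / (1 - (-s) ^ (m + 1))) := by
  have hne {x : ℂ} (hx : ‖x‖ < 1) : 1 - x ≠ 0 := by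
    intro h
    rw [← sub_eq_zero.mp h, norm_one] at hx
    exact lt_irrefl _ hx
  have he : 1 - (-s) ^ (m + 1) ≠ 0 :=
    hne (by rw [norm_pow, norm_neg]; exact pow_lt_one₀ (norm_nonneg _) hs (by omega))
  have hζn : ‖ζ‖ = 1 := hζ.norm'_eq_one (by omega)
  have hterm (j : ℕ) : ζ ^ j / (1 + ζ ^ j * s)
      = (∑ k ∈ Finset.range (m + 1), (-s) ^ k * (ζ ^ (k + 1)) ^ j) / (1 - (-s) ^ (m + 1)) := by
    have hd : 1 + ζ ^ j * s ≠ 0 := by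
      have := hne (x := -(ζ ^ j * s)) (by simpa [hζn] using hs)
      simpa using this
    rw [div_eq_div_iff hd he]
    have hg := mul_neg_geom_sum (ζ ^ j * -s) (m + 1)
    have hp : (ζ ^ j * -s) ^ (m + 1) = (-s) ^ (m + 1) := by
      rw [mul_pow, pow_right_comm, hζ.pow_eq_one, one_pow, one_mul]
    have hsum : ∑ k ∈ Finset.range (m + 1), (-s) ^ k * (ζ ^ (k + 1)) ^ j
        = ζ ^ j * ∑ k ∈ Finset.range (m + 1), (ζ ^ j * -s) ^ k := by
      rw [Finset.mul_sum]
      refine Finset.sum_congr rfl fun k _ => ?_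
      rw [pow_right_comm ζ (k + 1) j]
      ring
    rw [hsum, ← hp, ← hg]
    ring
  simp_rw [hterm]
  rw [← Finset.sum_div, Finset.sum_comm, mul_div_assoc']
  congr 1
  simp_rw [← Finset.mul_sum]
  rw [Finset.sum_range_succ, Finset.sum_eq_zero, hζ.pow_eq_one]
  · simp [mul_comm]
  · intro k hk
    have hk' := Finset.mem_range.mp hk
    have h1 : ζ ^ (k + 1) ≠ 1 := hζ.pow_ne_one_of_pos_of_lt (by omega) (by omega)
    have hg := mul_geom_sum (ζ ^ (k + 1)) (m + 1)
    rw [pow_right_comm, hζ.pow_eq_one, one_pow, sub_self] at hg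
    rw [Fin.sum_univ_eq_sum_range (fun j => (ζ ^ (k + 1)) ^ j),
      (mul_eq_zero.mp hg).resolve_left (sub_ne_zero.mpr h1), mul_zero]

/-- Polynomials of norm less than one are dense in the unit ball of the disc algebra. -/
theorem exists_polynomial_approx_of_norm_le_one {f : ℂ → ℂ}
    (hc : ContinuousOn f (closedBall (0 : ℂ) 1)) (hd : DifferentiableOn ℂ f (ball (0 : ℂ) 1))
    (hb : ∀ z ∈ closedBall (0 : ℂ) 1, ‖f z‖ ≤ 1) {ε : ℝ} (hε : 0 < ε) :
    ∃ (p : Polynomial ℂ) (ρ : ℝ), ρ < 1 ∧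
      ∀ z ∈ closedBall (0 : ℂ) 1, ‖p.eval z‖ ≤ ρ ∧ ‖p.eval z - f z‖ < ε := by
  obtain ⟨η, hη0, hη1, hηε⟩ : ∃ η : ℝ, 0 < η ∧ η ≤ 1 / 4 ∧ 8 * η ≤ ε :=
    ⟨min (1 / 4) (ε / 8), by positivity, min_le_left _ _, by
      have := min_le_right (1 / 4) (ε / 8); linarith⟩
  have huc := (isCompact_closedBall (0 : ℂ) 1).uniformContinuousOn_of_continuous hc
  obtain ⟨δ, hδ, hδf⟩ := Metric.uniformContinuousOn_iff.mp huc η hη0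
  obtain ⟨r, hr0, hr1, hrδ⟩ : ∃ r : ℝ, 0 < r ∧ r < 1 ∧ 1 - r < δ :=
    ⟨max (1 / 2) (1 - δ / 2), by positivity, max_lt (by norm_num) (by linarith), by
      have := le_max_right (1 / 2) (1 - δ / 2); linarith⟩
  obtain ⟨t, hrt, ht1⟩ := exists_between hr1
  obtain ⟨R, htR, hR1⟩ := exists_between ht1
  lift t to NNReal using by linarith
  lift R to NNReal using by linarith
  have hR0 : 0 < R := by
    rw [← NNReal.coe_pos]; linarith
  have hps := (hd.mono (closedBall_subset_ball hR1)).hasFPowerSeriesOnBall hR0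
  have hunif := hps.tendstoUniformlyOn (r' := t) (by exact_mod_cast htR)
  obtain ⟨N, hN⟩ := (Metric.tendstoUniformlyOn_iff.mp hunif η hη0).exists
  set S := cauchyPowerSeries f 0 R
  refine ⟨∑ k ∈ Finset.range N, Polynomial.C ((1 - 2 * η : ℝ) * ((r : ℂ) ^ k * S.coeff k)) *
    Polynomial.X ^ k, 1 - η, by linarith, fun z hz => ?_⟩
  have heval : (∑ k ∈ Finset.range N,
      Polynomial.C ((1 - 2 * η : ℝ) * ((r : ℂ) ^ k * S.coeff k)) * Polynomial.X ^ k).eval z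
      = (1 - 2 * η : ℝ) * S.partialSum N (r * z) := by
    rw [Polynomial.eval_finsetSum, FormalMultilinearSeries.partialSum, Finset.mul_sum]
    refine Finset.sum_congr rfl fun k _ => ?_
    rw [FormalMultilinearSeries.apply_eq_pow_smul_coeff, smul_eq_mul]
    simp
    ring
  rw [heval]
  have hz1 : ‖z‖ ≤ 1 := mem_closedBall_zero_iff.mp hz
  have hnrz : ‖(r : ℂ) * z‖ ≤ r := by
    rw [norm_mul, Complex.norm_of_nonneg hr0.le]
    exact mul_le_of_le_one_right hr0.le hz1
  have hrz : (r : ℂ) * z ∈ closedBall (0 : ℂ) 1 :=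
    mem_closedBall_zero_iff.mpr (hnrz.trans hr1.le)
  have h1 : ‖S.partialSum N (r * z) - f (r * z)‖ < η := by
    have := hN ((r : ℂ) * z) (mem_ball_zero_iff.mpr (hnrz.trans_lt hrt))
    rwa [zero_add, dist_comm, dist_eq_norm] at this
  have h2 : ‖f (r * z) - f z‖ < η := by
    rw [← dist_eq_norm]
    refine hδf _ hrz _ hz ?_
    rw [dist_eq_norm, show (r : ℂ) * z - z = -((1 - r : ℝ) * z) by push_cast; ring, norm_neg,
      norm_mul, Complex.norm_of_nonneg (by linarith)]
    exact (mul_le_of_le_one_right (by linarith) hz1).trans_lt hrδ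
  generalize S.partialSum N (r * z) = q at *
  have hq : ‖q‖ ≤ 1 + η := by
    have := norm_le_norm_add_norm_sub' q (f (r * z))
    linarith [hb _ hrz]
  constructor
  · rw [norm_mul, Complex.norm_of_nonneg (by linarith)]
    nlinarith [norm_nonneg q]
  · have h3 : ((1 - 2 * η : ℝ) : ℂ) * q - f z
        = (q - f (r * z)) + (f (r * z) - f z) - (2 * η : ℝ) * q := by
      push_cast; ring
    have h4 : ‖((2 * η : ℝ) : ℂ) * q‖ ≤ 4 * η := by
      rw [norm_mul, Complex.norm_of_nonneg (by linarith)]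
      nlinarith
    rw [h3]
    have := norm_sub_le ((q - f (r * z)) + (f (r * z) - f z)) ((2 * η : ℝ) * q)
    have := norm_add_le (q - f (r * z)) (f (r * z) - f z)
    linarith

/-- **Fisher's theorem.** Every function in the closed unit ball of the disc algebra can be
uniformly approximated on the open unit disc by convex combinations of finite Blaschke
products. -/
theorem fisher_convex_combination_finite_blaschke (f : ℂ → ℂ)
    (hc : ContinuousOn f (closedBall (0:ℂ) 1))
    (hd : DifferentiableOn ℂ f (ball (0:ℂ) 1))
    (hb : ∀ z ∈ closedBall (0:ℂ) 1, ‖f z‖ ≤ 1)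
    (ε : ℝ) (hε : 0 < ε) :
    ∃ (n : ℕ) (l : Fin n → ℝ) (B : Fin n → ℂ → ℂ),
      (∀ i, 0 ≤ l i) ∧ (∑ i, l i = 1) ∧
      (∀ i, IsFiniteBlaschkeOn (B i) (ball (0:ℂ) 1)) ∧
      ∀ z ∈ ball (0:ℂ) 1, ‖(∑ i, (l i : ℂ) * B i z) - f z‖ < ε := by
  obtain ⟨p, ρ, hρ1, hpρ⟩ := exists_polynomial_approx_of_norm_le_one hc hd hb (half_pos hε)
  have hρ : ∀ z ∈ closedBall (0 : ℂ) 1, ‖p.eval z‖ ≤ ρ := fun z hz => (hpρ z hz).1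
  have hρ0 : 0 ≤ ρ := (norm_nonneg _).trans (hρ 0 (by simp))
  obtain ⟨m, hm⟩ : ∃ m : ℕ, 2 * (ρ ^ m / (1 - ρ)) < ε / 2 := by
    obtain ⟨m, hm⟩ := exists_pow_lt_of_lt_one (y := ρ) (x := ε / 4 * (1 - ρ))
      (mul_pos (by linarith) (by linarith)) hρ1
    refine ⟨m, ?_⟩
    have := (div_lt_iff₀ (by linarith : 0 < 1 - ρ)).mpr hm
    linarith
  set n := p.natDegree + 1
  have hn : p.natDegree < n := Nat.lt_succ_self _
  have hζ := Complex.isPrimitiveRoot_exp (m + 1) (by omega)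
  set ζ := Complex.exp (2 * Real.pi * Complex.I / ((m + 1 : ℕ) : ℂ))
  have hζn : ‖ζ‖ = 1 := hζ.norm'_eq_one (by omega)
  have hm0 : ((m : ℂ) + 1) ≠ 0 := by exact_mod_cast Nat.succ_ne_zero m
  refine ⟨m + 1, fun _ => ((m : ℝ) + 1)⁻¹, fun j z =>
    (p.eval z + ζ ^ (j : ℕ) * z ^ n) / (1 + ζ ^ (j : ℕ) * conjReciprocal p n z),
    fun _ => by positivity, ?_, fun j => ?_, fun z hz => ?_⟩
  · have : (m : ℝ) + 1 ≠ 0 := by positivity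
    simp [this]
  · exact isFiniteBlaschkeOn_add_div hn hρ1 hρ (by simp [hζn])
  have hz' := ball_subset_closedBall hz
  beta_reduce
  have hs : ‖conjReciprocal p n z‖ ≤ ρ := norm_conjReciprocal_le hn hρ hz'
  generalize conjReciprocal p n z = s at *
  have hterm (j : ℕ) : (p.eval z + ζ ^ j * z ^ n) / (1 + ζ ^ j * s)
      = p.eval z + (z ^ n - p.eval z * s) * (ζ ^ j / (1 + ζ ^ j * s)) := by
    have hd : 1 + ζ ^ j * s ≠ 0 := by
      intro h
      have h2 : ‖ζ ^ j * s‖ ≤ ρ := by simpa [hζn] using hs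
      rw [← neg_eq_of_add_eq_zero_right h, norm_neg, norm_one] at h2
      linarith
    field_simp
    ring
  have havg : ∑ j : Fin (m + 1), ((((m : ℝ) + 1)⁻¹ : ℝ) : ℂ) *
      ((p.eval z + ζ ^ (j : ℕ) * z ^ n) / (1 + ζ ^ (j : ℕ) * s))
      = p.eval z + (z ^ n - p.eval z * s) * ((-s) ^ m / (1 - (-s) ^ (m + 1))) := by
    simp_rw [hterm]
    rw [← Finset.mul_sum, Finset.sum_add_distrib, ← Finset.mul_sum,
      sum_rootsOfUnity_div hζ (hs.trans_lt hρ1), Finset.sum_const, Finset.card_univ,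
      Fintype.card_fin, nsmul_eq_mul]
    push_cast
    field_simp
  have h1 : ‖z ^ n - p.eval z * s‖ ≤ 2 := by
    have hzn : ‖z ^ n‖ ≤ 1 := by
      rw [norm_pow]
      exact pow_le_one₀ (norm_nonneg _) (mem_closedBall_zero_iff.mp hz')
    have hps : ‖p.eval z * s‖ ≤ 1 := by
      rw [norm_mul]
      exact mul_le_one₀ ((hρ z hz').trans hρ1.le) (norm_nonneg _) (hs.trans hρ1.le)
    linarith [norm_sub_le (z ^ n) (p.eval z * s)]
  have h2 : ‖(-s) ^ m / (1 - (-s) ^ (m + 1))‖ ≤ ρ ^ m / (1 - ρ) := by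
    rw [norm_div]
    refine div_le_div₀ (by positivity) ?_ (by linarith) ?_
    · rw [norm_pow, norm_neg]
      gcongr
    · have h3 : ‖(-s) ^ (m + 1)‖ ≤ ρ := by
        rw [norm_pow, norm_neg]
        exact (pow_le_of_le_one (norm_nonneg _) (hs.trans hρ1.le) (by omega)).trans hs
      have := norm_sub_norm_le (1 : ℂ) ((-s) ^ (m + 1))
      rw [norm_one] at this
      linarith
  have h3 : ‖(z ^ n - p.eval z * s) * ((-s) ^ m / (1 - (-s) ^ (m + 1)))‖ < ε / 2 := by
    rw [norm_mul]
    exact (mul_le_mul h1 h2 (norm_nonneg _) zero_le_two).trans_lt hm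
  rw [havg, add_sub_right_comm]
  exact (norm_add_le _ _).trans_lt (by linarith [(hpρ z hz').2])
end

section
/- Let f : 𝕋 → ℂ be continuous with |f(ζ)| = 1 for all ζ ∈ 𝕋. Then there exists a continuous function g : 𝕋 → ℂ with |g(ζ)| = 1 for all ζ ∈ 𝕋 such that either f(ζ) = g(ζ)² for all ζ ∈ 𝕋, or f(ζ) = ζ·g(ζ)² for all ζ ∈ 𝕋. -/
open Complex Metric Set

/-- A continuous `2π`-periodic function on the line descends to the unit circle. -/
theorem exists_continuousOn_sphere_of_periodic {k : ℝ → ℂ} (hk : Continuous k)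
    (hp : Function.Periodic k (2 * Real.pi)) :
    ∃ g : ℂ → ℂ, ContinuousOn g (sphere (0:ℂ) 1) ∧ ∀ t : ℝ, g (exp (t * I)) = k t := by
  have hg : ∀ t : ℝ, k (arg (exp (t * I))) = k t := fun t ↦ by
    rw [arg_exp_mul_I, toIocMod, hp.sub_zsmul_eq]
  refine ⟨fun z ↦ k (arg z), ?_, hg⟩
  rw [continuousOn_iff_continuous_domRestrict]
  have hc : Continuous fun z : Circle ↦ k (arg z) := by
    rw [Circle.isAddQuotientCoveringMap_exp.toIsQuotientMap.continuous_iff]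
    exact hk.congr fun t ↦ by simpa using (hg t).symm
  exact hc.comp (f := fun z : sphere (0:ℂ) 1 ↦ (⟨z, z.2⟩ : Circle))
    (Continuous.subtype_mk continuous_subtype_val _)

/-- Every point of the unit circle is `exp (t * I)` for some real `t`. -/
theorem exists_exp_mul_I_eq_of_mem_sphere {z : ℂ} (hz : z ∈ sphere (0:ℂ) 1) :
    ∃ t : ℝ, exp (t * I) = z :=
  ⟨arg z, by simpa [mem_sphere_zero_iff_norm.mp hz] using norm_mul_exp_arg_mul_I z⟩

/-- A continuous unimodular function on the circle has a continuous square root after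
pulling back to the line, and this root is periodic or antiperiodic. -/
theorem exists_sq_eq_comp_exp_mul_I {f : ℂ → ℂ} (hf : ContinuousOn f (sphere (0:ℂ) 1))
    (hu : ∀ ζ ∈ sphere (0:ℂ) 1, f ζ ≠ 0) :
    ∃ h : ℝ → ℂ, Continuous h ∧ (∀ t : ℝ, h t ^ 2 = f (exp (t * I))) ∧
      (Function.Periodic h (2 * Real.pi) ∨ Function.Antiperiodic h (2 * Real.pi)) := by
  have hmem (t : ℝ) : exp (t * I) ∈ sphere (0:ℂ) 1 := by simp [norm_exp_ofReal_mul_I]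
  have hF : Continuous fun t : ℝ ↦ f (exp (t * I)) :=
    hf.comp_continuous (by fun_prop) hmem
  have hsc : IsSimplyConnected (univ : Set ℝ) :=
    @SimplyConnectedSpace.ofContractible _ _ (convex_univ.contractibleSpace univ_nonempty)
  obtain ⟨h, hc, hsq⟩ := exists_continuousOn_pow_eq hsc isOpen_univ hF.continuousOn
    (by rintro ⟨t, -, ht⟩; exact hu _ (hmem t) ht) two_ne_zero
  rw [continuousOn_univ] at hc
  refine ⟨h, hc, hsq, ?_⟩
  have hper : EqOn ((fun t ↦ h (t + 2 * Real.pi)) ^ 2) (h ^ 2) univ := fun t _ ↦ by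
    have : exp ((t + 2 * Real.pi : ℝ) * I) = exp (t * I) := by
      push_cast
      rw [add_mul, exp_add, exp_two_pi_mul_I, mul_one]
    simp only [Pi.pow_apply, hsq, this]
  rcases isPreconnected_univ.eq_or_eq_neg_of_sq_eq (by fun_prop) hc.continuousOn hper
    (fun {t} _ h0 ↦ hu _ (hmem t) (by rw [← hsq, h0]; simp)) with H | H
  · exact .inl fun t ↦ H (mem_univ t)
  · exact .inr fun t ↦ H (mem_univ t)

/-- **Square roots of continuous unimodular functions up to one Blaschke factor.**
Every continuous unimodular function `f` on the unit circle is either `g²` or `ζ·g(ζ)²`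
for some continuous unimodular function `g` on the circle. -/
theorem unimodular_square_root (f : ℂ → ℂ)
    (hf : ContinuousOn f (sphere (0:ℂ) 1))
    (hu : ∀ ζ ∈ sphere (0:ℂ) 1, ‖f ζ‖ = 1) :
    ∃ g : ℂ → ℂ, ContinuousOn g (sphere (0:ℂ) 1) ∧
      (∀ ζ ∈ sphere (0:ℂ) 1, ‖g ζ‖ = 1) ∧
      ((∀ ζ ∈ sphere (0:ℂ) 1, f ζ = g ζ ^ 2) ∨
       (∀ ζ ∈ sphere (0:ℂ) 1, f ζ = ζ * g ζ ^ 2)) := by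
  obtain ⟨h, hc, hsq, hp | hp⟩ := exists_sq_eq_comp_exp_mul_I hf fun ζ hζ h0 ↦ by
    simpa [h0] using hu ζ hζ
  · obtain ⟨g, hg, hgk⟩ := exists_continuousOn_sphere_of_periodic hc hp
    have hfg : ∀ ζ ∈ sphere (0:ℂ) 1, f ζ = g ζ ^ 2 := fun ζ hζ ↦ by
      obtain ⟨t, rfl⟩ := exists_exp_mul_I_eq_of_mem_sphere hζ
      rw [hgk, hsq]
    refine ⟨g, hg, fun ζ hζ ↦ ?_, .inl hfg⟩
    have := hu ζ hζ
    rwa [hfg ζ hζ, norm_pow, pow_eq_one_iff_of_nonneg (norm_nonneg _) two_ne_zero] at this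
  · have hp' : Function.Periodic (fun t : ℝ ↦ h t * exp (-(t / 2 * I))) (2 * Real.pi) := fun t ↦ by
      have : exp (-(((t + 2 * Real.pi : ℝ) : ℂ) / 2 * I)) = -exp (-(t / 2 * I)) := by
        push_cast
        rw [show -((t + 2 * Real.pi : ℂ) / 2 * I) = -(t / 2 * I) - Real.pi * I by ring,
          exp_sub, exp_pi_mul_I, div_neg, div_one]
      simp only [this, hp t, neg_mul_neg]
    obtain ⟨g, hg, hgk⟩ := exists_continuousOn_sphere_of_periodic (by fun_prop) hp'
    have hfg : ∀ ζ ∈ sphere (0:ℂ) 1, f ζ = ζ * g ζ ^ 2 := fun ζ hζ ↦ by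
      obtain ⟨t, rfl⟩ := exists_exp_mul_I_eq_of_mem_sphere hζ
      rw [hgk, mul_pow, hsq, ← exp_nat_mul, mul_left_comm, ← exp_add]
      ring_nf
      simp
    refine ⟨g, hg, fun ζ hζ ↦ ?_, .inr hfg⟩
    have := hu ζ hζ
    rwa [hfg ζ hζ, norm_mul, mem_sphere_zero_iff_norm.mp hζ, one_mul, norm_pow,
      pow_eq_one_iff_of_nonneg (norm_nonneg _) two_ne_zero] at this
end

section
/- Let f : 𝕋 → ℂ be continuous with sup_{ζ ∈ 𝕋} |f(ζ)| ≤ 1, and let ε > 0. Then there exist continuous functions u₁, …, u_n : 𝕋 → ℂ with |u_j(ζ)| = 1 for all ζ ∈ 𝕋, and nonnegative reals λ₁, …, λ_n with λ₁ + ⋯ + λ_n = 1, such that sup_{ζ ∈ 𝕋} |λ₁u₁(ζ) + ⋯ + λ_nu_n(ζ) − f(ζ)| < ε. -/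
open Complex Metric Set

open scoped ComplexConjugate

/-- Power sums of the `n`-th roots of unity vanish for exponents `0 < k < n`. -/
theorem sum_pow_primitiveRoot_eq_zero {n k : ℕ} {w : ℂ} (hw : IsPrimitiveRoot w n)
    (hk : k ≠ 0) (hkn : k < n) : ∑ j ∈ Finset.range n, (w ^ j) ^ k = 0 := by
  have h1 : w ^ k ≠ 1 := hw.pow_ne_one_of_pos_of_lt hk hkn
  have h2 : ∀ j, (w ^ j) ^ k = (w ^ k) ^ j := fun j => by rw [← pow_mul, ← pow_mul, mul_comm]
  simp_rw [h2]
  rw [geom_sum_eq h1, ← pow_mul, mul_comm, pow_mul, hw.pow_eq_one]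
  simp

/-- The sum of `(z + g) / (1 - b z)` over the roots of unity `z` of order `N + 1`. -/
theorem sum_moebius_primitiveRoot {N : ℕ} {w : ℂ} (hw : IsPrimitiveRoot w (N + 1))
    (g : ℂ) {b : ℂ} (hb : ‖b‖ < 1) :
    ∑ j ∈ Finset.range (N + 1), (w ^ j + g) / (1 - b * w ^ j)
      = (N + 1) * ((g + b ^ N) / (1 - b ^ (N + 1))) := by
  have hone : ∀ z : ℂ, ‖z‖ < 1 → 1 - z ≠ 0 := by
    intro z hz h
    rw [← sub_eq_zero.1 h] at hz
    simp at hz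
  have hbn : 1 - b ^ (N + 1) ≠ 0 :=
    hone _ (by rw [norm_pow]; exact pow_lt_one₀ (norm_nonneg _) hb (by simp))
  have hw1 : ‖w‖ = 1 := hw.norm'_eq_one (by simp)
  have hz : ∀ j, (w ^ j) ^ (N + 1) = 1 := fun j => by
    rw [← pow_mul, mul_comm, pow_mul, hw.pow_eq_one, one_pow]
  have hterm : ∀ j, (w ^ j + g) / (1 - b * w ^ j)
      = (∑ k ∈ Finset.range (N + 1), (b ^ k * (w ^ j) ^ (k + 1) + g * b ^ k * (w ^ j) ^ k))
        / (1 - b ^ (N + 1)) := by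
    intro j
    have h1 : 1 - b * w ^ j ≠ 0 := hone _ (by simpa [hw1] using hb)
    rw [div_eq_div_iff h1 hbn]
    have h2 := mul_neg_geom_sum (b * w ^ j) (N + 1)
    rw [mul_pow, hz, mul_one] at h2
    have h3 : ∑ k ∈ Finset.range (N + 1), (b ^ k * (w ^ j) ^ (k + 1) + g * b ^ k * (w ^ j) ^ k)
        = (w ^ j + g) * ∑ k ∈ Finset.range (N + 1), (b * w ^ j) ^ k := by
      rw [Finset.mul_sum]
      refine Finset.sum_congr rfl fun k _ => ?_
      ring
    rw [h3, ← h2]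
    ring
  simp_rw [hterm]
  rw [← Finset.sum_div, Finset.sum_comm, mul_div_assoc']
  congr 1
  simp_rw [Finset.sum_add_distrib, ← Finset.mul_sum]
  have hfst : ∑ k ∈ Finset.range N, b ^ k * ∑ j ∈ Finset.range (N + 1), (w ^ j) ^ (k + 1) = 0 :=
    Finset.sum_eq_zero fun k hk => by
      rw [sum_pow_primitiveRoot_eq_zero hw (by simp) (by simpa using hk), mul_zero]
  have hsnd : ∑ k ∈ Finset.range N,
      g * b ^ (k + 1) * ∑ j ∈ Finset.range (N + 1), (w ^ j) ^ (k + 1) = 0 :=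
    Finset.sum_eq_zero fun k hk => by
      rw [sum_pow_primitiveRoot_eq_zero hw (by simp) (by simpa using hk), mul_zero]
  rw [Finset.sum_range_succ (fun k => b ^ k * _), hfst,
    Finset.sum_range_succ' (fun k => g * b ^ k * _), hsnd]
  simp only [hz, pow_zero, Finset.sum_const, Finset.card_range, nsmul_eq_mul]
  push_cast
  ring

/-- Disc automorphisms are unimodular on the unit circle. -/
theorem norm_moebius_eq_one {z g : ℂ} (hz : ‖z‖ = 1) (hg : ‖g‖ < 1) :
    ‖(z + g) / (1 - (-conj g) * z)‖ = 1 := by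
  have hzz : z * conj z = 1 := by rw [Complex.mul_conj, Complex.normSq_eq_norm_sq, hz]; simp
  have h : 1 - (-conj g) * z = z * conj (z + g) := by
    rw [map_add, mul_add, hzz]
    ring
  have hne : z + g ≠ 0 := by
    intro h0
    rw [← norm_neg, ← eq_neg_of_add_eq_zero_left h0, hz] at hg
    exact lt_irrefl _ hg
  rw [h, norm_div, norm_mul, hz, one_mul, Complex.norm_conj, div_self (norm_ne_zero_iff.2 hne)]

/-- Quantitative averaging of disc automorphisms over roots of unity. -/
theorem norm_moebius_average_sub_le {N : ℕ} {r : ℝ} (hr : r < 1) {g b : ℂ}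
    (hg : ‖g‖ ≤ r) (hb : ‖b‖ ≤ r) :
    ‖(g + b ^ N) / (1 - b ^ (N + 1)) - g‖ ≤ 2 * r ^ N / (1 - r) := by
  have hr0 : 0 ≤ r := (norm_nonneg _).trans hg
  have hbN : ‖b ^ N‖ ≤ r ^ N := by rw [norm_pow]; gcongr
  have hbN1 : ‖b ^ (N + 1)‖ ≤ r := by
    rw [norm_pow, pow_succ]
    calc ‖b‖ ^ N * ‖b‖ ≤ 1 * r := by
          gcongr
          exact pow_le_one₀ (norm_nonneg _) (hb.trans hr.le)
      _ = r := one_mul r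
  have hden : 1 - r ≤ ‖1 - b ^ (N + 1)‖ := by
    have := norm_sub_norm_le (1 : ℂ) (b ^ (N + 1))
    rw [norm_one] at this
    linarith
  have hne : 1 - b ^ (N + 1) ≠ 0 := norm_pos_iff.1 (by linarith)
  have heq : (g + b ^ N) / (1 - b ^ (N + 1)) - g
      = b ^ N * (1 + g * b) / (1 - b ^ (N + 1)) := by
    field_simp
    ring
  rw [heq, norm_div, norm_mul]
  have h2 : ‖1 + g * b‖ ≤ 2 := by
    have h3 := norm_add_le (1 : ℂ) (g * b)
    rw [norm_one, norm_mul] at h3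
    nlinarith [norm_nonneg g, norm_nonneg b]
  have : 0 < 1 - r := by linarith
  have : 0 ≤ r ^ N := by positivity
  rw [mul_comm 2]
  gcongr

/-- Every function in the closed unit ball of `C(𝕋)` can be uniformly approximated by convex
combinations of continuous unimodular functions on the unit circle. -/
theorem convex_combination_unimodular_continuous (f : ℂ → ℂ)
    (hf : ContinuousOn f (sphere (0:ℂ) 1))
    (hb : ∀ ζ ∈ sphere (0:ℂ) 1, ‖f ζ‖ ≤ 1)
    (ε : ℝ) (hε : 0 < ε) :
    ∃ (n : ℕ) (l : Fin n → ℝ) (u : Fin n → ℂ → ℂ),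
      (∀ i, 0 ≤ l i) ∧ (∑ i, l i = 1) ∧
      (∀ i, ContinuousOn (u i) (sphere (0:ℂ) 1)) ∧
      (∀ i, ∀ ζ ∈ sphere (0:ℂ) 1, ‖u i ζ‖ = 1) ∧
      ∀ ζ ∈ sphere (0:ℂ) 1, ‖(∑ i, (l i : ℂ) * u i ζ) - f ζ‖ < ε := by
  obtain ⟨r, hr0, hr1, hre⟩ : ∃ r : ℝ, 0 ≤ r ∧ r < 1 ∧ 1 - r < ε / 2 := by
    refine ⟨1 - min (1 / 2) (ε / 3), ?_, ?_, ?_⟩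
    · linarith [min_le_left (1 / 2) (ε / 3)]
    · have : 0 < min (1 / 2) (ε / 3) := by positivity
      linarith
    · linarith [min_le_right (1 / 2) (ε / 3)]
  have hpos : 0 < 1 - r := by linarith
  obtain ⟨N, hrN⟩ := exists_pow_lt_of_lt_one (show 0 < ε * (1 - r) / 4 by positivity) hr1
  have hN : 2 * r ^ N / (1 - r) < ε / 2 := by
    rw [div_lt_iff₀ hpos]
    linarith
  have hw := Complex.isPrimitiveRoot_exp (N + 1) (by simp)
  set w := Complex.exp (2 * Real.pi * I / ((N + 1 : ℕ) : ℂ))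
  have hwj : ∀ j : ℕ, ‖w ^ j‖ = 1 := fun j => by
    rw [norm_pow, hw.norm'_eq_one (by simp), one_pow]
  have hg : ∀ ζ ∈ sphere (0:ℂ) 1, ‖(r : ℂ) * f ζ‖ ≤ r := fun ζ hζ => by
    rw [norm_mul, Complex.norm_real, Real.norm_of_nonneg hr0]
    exact mul_le_of_le_one_right hr0 (hb ζ hζ)
  have hu : ∀ j : ℕ, ∀ ζ ∈ sphere (0:ℂ) 1,
      ‖(w ^ j + r * f ζ) / (1 - (-conj (r * f ζ)) * w ^ j)‖ = 1 := fun j ζ hζ =>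
    norm_moebius_eq_one (hwj j) ((hg ζ hζ).trans_lt hr1)
  refine ⟨N + 1, fun _ => ((N : ℝ) + 1)⁻¹,
    fun j ζ => (w ^ (j : ℕ) + r * f ζ) / (1 - (-conj (r * f ζ)) * w ^ (j : ℕ)),
    fun _ => by positivity, ?_, ?_, fun j => hu j, ?_⟩
  · have : (N : ℝ) + 1 ≠ 0 := by positivity
    simp [this]
  · intro j
    have hgc : ContinuousOn (fun ζ => (r : ℂ) * f ζ) (sphere (0:ℂ) 1) :=
      continuousOn_const.mul hf
    refine (continuousOn_const.add hgc).div (continuousOn_const.sub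
      ((Complex.continuous_conj.comp_continuousOn hgc).neg.mul continuousOn_const)) ?_
    intro ζ hζ h0
    have := hu j ζ hζ
    rw [show 1 - (-conj (r * f ζ)) * w ^ (j : ℕ) = 0 from h0] at this
    simp at this
  · intro ζ hζ
    have hc : ‖-conj ((r : ℂ) * f ζ)‖ ≤ r := by
      rw [norm_neg, Complex.norm_conj]
      exact hg ζ hζ
    have hsum := sum_moebius_primitiveRoot hw (r * f ζ) (hc.trans_lt hr1)
    rw [← Finset.mul_sum, Fin.sum_univ_eq_sum_range
      (fun j => (w ^ j + r * f ζ) / (1 - (-conj (r * f ζ)) * w ^ j)), hsum]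
    have hne : (N : ℂ) + 1 ≠ 0 := by exact_mod_cast N.succ_ne_zero
    rw [← mul_assoc]
    push_cast
    rw [inv_mul_cancel₀ hne, one_mul]
    have h1 := norm_moebius_average_sub_le (N := N) hr1 (hg ζ hζ) hc
    have h2 : ‖(r : ℂ) * f ζ - f ζ‖ ≤ 1 - r := by
      have : (r : ℂ) * f ζ - f ζ = -(((1 - r : ℝ) : ℂ) * f ζ) := by
        push_cast
        ring
      rw [this, norm_neg, norm_mul, Complex.norm_real, Real.norm_of_nonneg hpos.le]
      exact mul_le_of_le_one_right hpos.le (hb ζ hζ)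
    have h3 := norm_sub_le_norm_sub_add_norm_sub
      (((r : ℂ) * f ζ + (-conj ((r : ℂ) * f ζ)) ^ N) / (1 - (-conj ((r : ℂ) * f ζ)) ^ (N + 1)))
      (r * f ζ) (f ζ)
    linarith
end
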